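/- In ℚ[SL₂(F)], the four elements π₁, π₂, π₃, π₄ are pairwise orthogonal idempotents: πᵢ·πᵢ = πᵢ for i = 1,2,3,4 and πᵢ·πⱼ = 0 for i ≠ j; moreover π₁ + π₂ + π₃ + π₄ = (1/(q−1))·A, and (1/(q−1))·A·X = X·(1/(q−1))·A = X for every X ∈ {A, B, C, D₊, D₋, E₊, E₋} (so (1/(q−1))A is the identity of the span of the seven support-class elements). -/

import Mathlib

open MonoidAlgebra

/-- Sum of all elements of `SL₂(F)` whose support pattern is given by the four
Booleans (`true` = the entry is nonzero, `false` = the entry is zero). -/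
noncomputable def suppClass (R : Type*) [CommRing R] (F : Type*) [Field F] [Fintype F]
    [DecidableEq F] (b₁₁ b₁₂ b₂₁ b₂₂ : Bool) :
    MonoidAlgebra R (Matrix.SpecialLinearGroup (Fin 2) F) :=
  ∑ g ∈ Finset.univ.filter
      (fun g : Matrix.SpecialLinearGroup (Fin 2) F =>
        (b₁₁ = true ↔ (g : Matrix (Fin 2) (Fin 2) F) 0 0 ≠ 0) ∧
        (b₁₂ = true ↔ (g : Matrix (Fin 2) (Fin 2) F) 0 1 ≠ 0) ∧
        (b₂₁ = true ↔ (g : Matrix (Fin 2) (Fin 2) F) 1 0 ≠ 0) ∧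
        (b₂₂ = true ↔ (g : Matrix (Fin 2) (Fin 2) F) 1 1 ≠ 0)),
    MonoidAlgebra.of R (Matrix.SpecialLinearGroup (Fin 2) F) g

/-- The support class `A` (diagonal matrices). -/
noncomputable def elA (R : Type*) [CommRing R] (F : Type*) [Field F] [Fintype F] [DecidableEq F] :=
  suppClass R F true false false true
/-- The support class `B` (antidiagonal matrices). -/
noncomputable def elB (R : Type*) [CommRing R] (F : Type*) [Field F] [Fintype F] [DecidableEq F] :=
  suppClass R F false true true false
/-- The support class `C` (matrices with all entries nonzero). -/
noncomputable def elC (R : Type*) [CommRing R] (F : Type*) [Field F] [Fintype F] [DecidableEq F] :=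
  suppClass R F true true true true
/-- The support class `D₊` (upper triangular with nonzero entries). -/
noncomputable def elDp (R : Type*) [CommRing R] (F : Type*) [Field F] [Fintype F] [DecidableEq F] :=
  suppClass R F true true false true
/-- The support class `D₋` (lower triangular with nonzero entries). -/
noncomputable def elDm (R : Type*) [CommRing R] (F : Type*) [Field F] [Fintype F] [DecidableEq F] :=
  suppClass R F true false true true
/-- The support class `E₊`. -/
noncomputable def elEp (R : Type*) [CommRing R] (F : Type*) [Field F] [Fintype F] [DecidableEq F] :=
  suppClass R F true true true false
/-- The support class `E₋`. -/
noncomputable def elEm (R : Type*) [CommRing R] (F : Type*) [Field F] [Fintype F] [DecidableEq F] :=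
  suppClass R F false true true true

section helpers
variable {F : Type*} [Field F] [Fintype F] [DecidableEq F]

/-- element of the group algebra with coefficient function `f` -/
noncomputable def KK (f : Matrix.SpecialLinearGroup (Fin 2) F → ℚ) :
    MonoidAlgebra ℚ (Matrix.SpecialLinearGroup (Fin 2) F) :=
  ∑ g, f g • MonoidAlgebra.of ℚ (Matrix.SpecialLinearGroup (Fin 2) F) g

lemma of_mul_KK (g : Matrix.SpecialLinearGroup (Fin 2) F) (f) :
    MonoidAlgebra.of ℚ _ g * KK f = KK (fun h => f (g⁻¹ * h)) := by
  unfold KK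
  rw [Finset.mul_sum]
  refine Fintype.sum_equiv (Equiv.mulLeft g) _ _ fun h => ?_
  simp only [Equiv.coe_mulLeft, inv_mul_cancel_left, map_mul, mul_smul_comm]

lemma KK_mul_of (g : Matrix.SpecialLinearGroup (Fin 2) F) (f) :
    KK f * MonoidAlgebra.of ℚ _ g = KK (fun h => f (h * g⁻¹)) := by
  unfold KK
  rw [Finset.sum_mul]
  refine Fintype.sum_equiv (Equiv.mulRight g) _ _ fun h => ?_
  simp only [Equiv.coe_mulRight, mul_inv_cancel_right, map_mul, smul_mul_assoc]

lemma KK_add (f f' : Matrix.SpecialLinearGroup (Fin 2) F → ℚ) :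
    KK f + KK f' = KK (f + f') := by
  simp [KK, Finset.sum_add_distrib, add_smul]

lemma KK_sub (f f' : Matrix.SpecialLinearGroup (Fin 2) F → ℚ) :
    KK f - KK f' = KK (f - f') := by
  simp [KK, Finset.sum_sub_distrib, sub_smul]

lemma KK_smul (c : ℚ) (f : Matrix.SpecialLinearGroup (Fin 2) F → ℚ) :
    c • KK f = KK (fun g => c * f g) := by
  simp [KK, Finset.smul_sum, mul_smul]

lemma KK_sum {ι : Type*} (s : Finset ι) (f : ι → Matrix.SpecialLinearGroup (Fin 2) F → ℚ) :
    ∑ i ∈ s, KK (f i) = KK (fun g => ∑ i ∈ s, f i g) := by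
  simp only [KK, Finset.sum_smul]
  rw [Finset.sum_comm]

lemma suppClass_eq (a b c d : Bool) : suppClass ℚ F a b c d = KK (fun g =>
    if ((a = true ↔ g 0 0 ≠ 0) ∧ (b = true ↔ g 0 1 ≠ 0) ∧
      (c = true ↔ g 1 0 ≠ 0) ∧ (d = true ↔ g 1 1 ≠ 0)) then 1 else 0) := by
  simp only [suppClass, KK, Finset.sum_filter, ite_smul, one_smul, zero_smul]

/-- the Weyl element -/
def ww (F : Type*) [Field F] : Matrix.SpecialLinearGroup (Fin 2) F :=
  ⟨!![0, 1; -1, 0], by simp [Matrix.det_fin_two]⟩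

/-- upper triangular element -/
def bb (p : Fˣ × F) : Matrix.SpecialLinearGroup (Fin 2) F :=
  ⟨!![(p.1 : F), p.2; 0, ((p.1⁻¹ : Fˣ) : F)], by simp [Matrix.det_fin_two]⟩

lemma ww_val : ((ww F : Matrix.SpecialLinearGroup (Fin 2) F) : Matrix (Fin 2) (Fin 2) F) =
    !![0, 1; -1, 0] := rfl

lemma bb_val (p : Fˣ × F) : ((bb p : Matrix.SpecialLinearGroup (Fin 2) F) :
    Matrix (Fin 2) (Fin 2) F) = !![(p.1 : F), p.2; 0, ((p.1⁻¹ : Fˣ) : F)] := rfl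

lemma detrel (g : Matrix.SpecialLinearGroup (Fin 2) F) : g 0 0 * g 1 1 - g 0 1 * g 1 0 = 1 := by
  rw [← Matrix.det_fin_two]; exact g.2

lemma ww_l (g : Matrix.SpecialLinearGroup (Fin 2) F) :
    ((ww F)⁻¹ * g) 0 0 = - g 1 0 ∧ ((ww F)⁻¹ * g) 0 1 = - g 1 1 ∧
    ((ww F)⁻¹ * g) 1 0 = g 0 0 ∧ ((ww F)⁻¹ * g) 1 1 = g 0 1 := by
  simp [ww_val, Matrix.SpecialLinearGroup.coe_mul, Matrix.mul_apply, Matrix.adjugate_fin_two]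

lemma ww_r (g : Matrix.SpecialLinearGroup (Fin 2) F) :
    (g * (ww F)⁻¹) 0 0 = g 0 1 ∧ (g * (ww F)⁻¹) 0 1 = - g 0 0 ∧
    (g * (ww F)⁻¹) 1 0 = g 1 1 ∧ (g * (ww F)⁻¹) 1 1 = - g 1 0 := by
  simp [ww_val, Matrix.SpecialLinearGroup.coe_mul, Matrix.mul_apply, Matrix.adjugate_fin_two]

lemma bb_l (p : Fˣ × F) (g : Matrix.SpecialLinearGroup (Fin 2) F) :
    ((bb p)⁻¹ * g) 0 0 = (p.1⁻¹ : Fˣ) * g 0 0 - p.2 * g 1 0 ∧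
    ((bb p)⁻¹ * g) 0 1 = (p.1⁻¹ : Fˣ) * g 0 1 - p.2 * g 1 1 ∧
    ((bb p)⁻¹ * g) 1 0 = p.1 * g 1 0 ∧ ((bb p)⁻¹ * g) 1 1 = p.1 * g 1 1 := by
  simp [bb_val, Matrix.SpecialLinearGroup.coe_mul, Matrix.mul_apply, Matrix.adjugate_fin_two]
  constructor <;> ring

lemma bb_r (p : Fˣ × F) (g : Matrix.SpecialLinearGroup (Fin 2) F) :
    (g * (bb p)⁻¹) 0 0 = g 0 0 * (p.1⁻¹ : Fˣ) ∧
    (g * (bb p)⁻¹) 0 1 = - g 0 0 * p.2 + g 0 1 * p.1 ∧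
    (g * (bb p)⁻¹) 1 0 = g 1 0 * (p.1⁻¹ : Fˣ) ∧
    (g * (bb p)⁻¹) 1 1 = - g 1 0 * p.2 + g 1 1 * p.1 := by
  simp [bb_val, Matrix.SpecialLinearGroup.coe_mul, Matrix.mul_apply, Matrix.adjugate_fin_two]

/-- Borel sum -/
noncomputable def PP (F : Type*) [Field F] [Fintype F] [DecidableEq F] :
    MonoidAlgebra ℚ (Matrix.SpecialLinearGroup (Fin 2) F) :=
  KK (fun g => if g 1 0 = 0 then 1 else 0)

/-- torus sum -/
noncomputable def TT (F : Type*) [Field F] [Fintype F] [DecidableEq F] :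
    MonoidAlgebra ℚ (Matrix.SpecialLinearGroup (Fin 2) F) :=
  KK (fun g => if g 1 0 = 0 ∧ g 0 1 = 0 then 1 else 0)

/-- total sum -/
noncomputable def SS (F : Type*) [Field F] [Fintype F] [DecidableEq F] :
    MonoidAlgebra ℚ (Matrix.SpecialLinearGroup (Fin 2) F) :=
  KK (fun _ => 1)

/-- Weyl element in the algebra -/
noncomputable def W (F : Type*) [Field F] :
    MonoidAlgebra ℚ (Matrix.SpecialLinearGroup (Fin 2) F) :=
  MonoidAlgebra.of ℚ _ (ww F)

lemma bb_inj : Function.Injective (bb (F := F)) := by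
  rintro ⟨a, x⟩ ⟨b, y⟩ h
  have h0 := congrArg (fun g : Matrix.SpecialLinearGroup (Fin 2) F => g 0 0) h
  have h1 := congrArg (fun g : Matrix.SpecialLinearGroup (Fin 2) F => g 0 1) h
  simp [bb_val] at h0 h1
  simp [Units.ext h0, h1]

lemma bb_surj (g : Matrix.SpecialLinearGroup (Fin 2) F) (h : g 1 0 = 0) :
    ∃ a : Fˣ, bb (a, g 0 1) = g := by
  have hd := detrel g
  rw [h, mul_zero, sub_zero] at hd
  have h0 : g 0 0 ≠ 0 := by rintro h; simp [h] at hd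
  refine ⟨Units.mk0 _ h0, ?_⟩
  ext i j
  fin_cases i <;> fin_cases j <;> simp [bb_val, h]
  exact inv_eq_of_mul_eq_one_right hd

lemma PP_eq : PP F = ∑ p : Fˣ × F, MonoidAlgebra.of ℚ _ (bb p) := by
  simp only [PP, KK, ite_smul, one_smul, zero_smul]
  rw [← Finset.sum_filter]
  symm
  refine Finset.sum_nbij bb ?_ bb_inj.injOn ?_ ?_
  · intro p _; simp [bb_val]
  · intro g hg
    obtain ⟨a, ha⟩ := bb_surj g (by simpa using hg)
    exact ⟨(a, g 0 1), by simp, ha⟩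
  · simp

lemma TT_eq : TT F = ∑ a : Fˣ, MonoidAlgebra.of ℚ _ (bb (a, (0 : F))) := by
  simp only [TT, KK, ite_smul, one_smul, zero_smul]
  rw [← Finset.sum_filter]
  symm
  refine Finset.sum_nbij (fun a => bb (a, (0 : F))) ?_ ?_ ?_ ?_
  · intro p _; simp [bb_val]
  · intro a _ b _ h
    simpa using bb_inj h
  · intro g hg
    have hg' : g 1 0 = 0 ∧ g 0 1 = 0 := by simpa using hg
    obtain ⟨a, ha⟩ := bb_surj g hg'.1
    rw [hg'.2] at ha
    exact ⟨a, by simp, ha⟩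
  · simp

lemma bb_PP (p : Fˣ × F) : MonoidAlgebra.of ℚ _ (bb p) * PP F = PP F := by
  rw [PP, of_mul_KK]
  congr 1; funext g
  simp [bb_l]

lemma PP_bb (p : Fˣ × F) : PP F * MonoidAlgebra.of ℚ _ (bb p) = PP F := by
  rw [PP, KK_mul_of]
  congr 1; funext g
  simp [bb_r]

lemma bb_TT (a : Fˣ) : MonoidAlgebra.of ℚ _ (bb (a, (0 : F))) * TT F = TT F := by
  rw [TT, of_mul_KK]
  congr 1; funext g
  simp [bb_l]

lemma SS_of (g : Matrix.SpecialLinearGroup (Fin 2) F) :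
    SS F * MonoidAlgebra.of ℚ _ g = SS F := by
  rw [SS, KK_mul_of]

lemma of_SS (g : Matrix.SpecialLinearGroup (Fin 2) F) :
    MonoidAlgebra.of ℚ _ g * SS F = SS F := by
  rw [SS, of_mul_KK]

lemma card_q : ((Fintype.card Fˣ : ℕ) : ℚ) = (Fintype.card F : ℚ) - 1 := by
  rw [Fintype.card_units, Nat.cast_sub Fintype.card_pos]; simp

lemma card_u (q : ℚ) (hq : q = Fintype.card F) : ((Fintype.card Fˣ : ℕ) : ℚ) = q - 1 := by rw [card_q, hq]

lemma TT_TT (q : ℚ) (hq : q = Fintype.card F) : TT F * TT F = (q - 1) • TT F := by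
  conv_lhs => enter [1]; rw [TT_eq]
  simp only [Finset.sum_mul, bb_TT]
  simp [← card_u q hq, ← Nat.cast_smul_eq_nsmul ℚ]

lemma TT_PP (q : ℚ) (hq : q = Fintype.card F) : TT F * PP F = (q - 1) • PP F := by
  rw [TT_eq]
  simp only [Finset.sum_mul, bb_PP]
  simp [← card_u q hq, ← Nat.cast_smul_eq_nsmul ℚ]

lemma PP_TT (q : ℚ) (hq : q = Fintype.card F) : PP F * TT F = (q - 1) • PP F := by
  rw [TT_eq]
  simp only [Finset.mul_sum, PP_bb]
  simp [← card_u q hq, ← Nat.cast_smul_eq_nsmul ℚ]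

lemma PP_PP (q : ℚ) (hq : q = Fintype.card F) : PP F * PP F = (q * (q - 1)) • PP F := by
  conv_lhs => enter [1]; rw [PP_eq]
  simp only [Finset.sum_mul, bb_PP]
  rw [Finset.sum_const, ← Nat.cast_smul_eq_nsmul ℚ]
  congr 1
  rw [Finset.card_univ, Fintype.card_prod, Nat.cast_mul, card_u q hq, hq]; ring

lemma SS_TT (q : ℚ) (hq : q = Fintype.card F) : SS F * TT F = (q - 1) • SS F := by
  rw [TT_eq]
  simp only [Finset.mul_sum, SS_of]
  simp [← card_u q hq, ← Nat.cast_smul_eq_nsmul ℚ]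

lemma TT_SS (q : ℚ) (hq : q = Fintype.card F) : TT F * SS F = (q - 1) • SS F := by
  rw [TT_eq]
  simp only [Finset.sum_mul, of_SS]
  simp [← card_u q hq, ← Nat.cast_smul_eq_nsmul ℚ]

lemma SS_PP (q : ℚ) (hq : q = Fintype.card F) : SS F * PP F = (q * (q - 1)) • SS F := by
  rw [PP_eq]
  simp only [Finset.mul_sum, SS_of]
  rw [Finset.sum_const, ← Nat.cast_smul_eq_nsmul ℚ]
  congr 1
  rw [Finset.card_univ, Fintype.card_prod, Nat.cast_mul, card_u q hq, hq]; ring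

lemma PP_SS (q : ℚ) (hq : q = Fintype.card F) : PP F * SS F = (q * (q - 1)) • SS F := by
  rw [PP_eq]
  simp only [Finset.sum_mul, of_SS]
  rw [Finset.sum_const, ← Nat.cast_smul_eq_nsmul ℚ]
  congr 1
  rw [Finset.card_univ, Fintype.card_prod, Nat.cast_mul, card_u q hq, hq]; ring

lemma PP_W_PP (q : ℚ) (hq : q = Fintype.card F) : PP F * (W F * PP F) = (q - 1) • SS F - (q - 1) • PP F := by
  conv_lhs => enter [1]; rw [PP_eq]
  rw [Finset.sum_mul]
  simp only [W, PP, of_mul_KK, KK_sum, SS, KK_smul, KK_sub]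
  congr 1; funext g
  simp only [ww_l, bb_l, Fintype.sum_prod_type, Pi.sub_apply]
  by_cases h : g 1 0 = 0
  · have hd := detrel g
    rw [h, mul_zero, sub_zero] at hd
    have h0 : g 0 0 ≠ 0 := by rintro h; simp [h] at hd
    simp [h, h0]
  · have : ∀ (a : Fˣ) (x : F), ((a⁻¹ : Fˣ) : F) * g 0 0 - x * g 1 0 = 0 ↔
        x = ((a⁻¹ : Fˣ) : F) * g 0 0 / g 1 0 := by
      intro a x
      rw [eq_div_iff h, sub_eq_zero, eq_comm]
    simp only [this]
    simp [h, card_u q hq]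

lemma W_SS : W F * SS F = SS F := of_SS _
lemma SS_W : SS F * W F = SS F := SS_of _

lemma W_TT : W F * TT F = TT F * W F := by
  simp only [W, TT, of_mul_KK, KK_mul_of]
  congr 1; funext g
  simp [ww_l, ww_r, and_comm]

lemma W_W_PP : W F * (W F * PP F) = PP F := by
  simp only [W, PP, of_mul_KK, KK_mul_of]
  congr 1; funext g
  simp [ww_l, ww_r]

lemma PP_W_W : PP F * W F * W F = PP F := by
  simp only [W, PP, of_mul_KK, KK_mul_of]
  congr 1; funext g
  simp [ww_l, ww_r]

lemma TT_W_W : TT F * W F * W F = TT F := by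
  simp only [W, TT, of_mul_KK, KK_mul_of]
  congr 1; funext g
  simp [ww_l, ww_r]

lemma elA_eq : elA ℚ F = TT F := by
  rw [elA, suppClass_eq, TT]
  congr 1; funext g
  have hd := detrel g
  congr 1
  apply propext
  by_cases h1 : g 0 0 = 0 <;> by_cases h2 : g 0 1 = 0 <;> by_cases h3 : g 1 0 = 0 <;>
    by_cases h4 : g 1 1 = 0 <;> simp [h1, h2, h3, h4] at hd ⊢

lemma elB_eq : elB ℚ F = TT F * W F := by
  rw [elB, suppClass_eq, TT, W, KK_mul_of]
  congr 1; funext g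
  have hd := detrel g
  congr 1
  apply propext
  by_cases h1 : g 0 0 = 0 <;> by_cases h2 : g 0 1 = 0 <;> by_cases h3 : g 1 0 = 0 <;>
    by_cases h4 : g 1 1 = 0 <;> simp [h1, h2, h3, h4, ww_r] at hd ⊢

lemma elDp_eq : elDp ℚ F = PP F - TT F := by
  rw [elDp, suppClass_eq, TT, PP, KK_sub]
  congr 1; funext g
  have hd := detrel g
  by_cases h1 : g 0 0 = 0 <;> by_cases h2 : g 0 1 = 0 <;> by_cases h3 : g 1 0 = 0 <;>
    by_cases h4 : g 1 1 = 0 <;> simp [h1, h2, h3, h4] at hd ⊢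

lemma elDm_eq : elDm ℚ F = W F * PP F * W F - TT F := by
  rw [elDm, suppClass_eq, TT, PP, W, of_mul_KK, KK_mul_of, KK_sub]
  congr 1; funext g
  have hd := detrel g
  by_cases h1 : g 0 0 = 0 <;> by_cases h2 : g 0 1 = 0 <;> by_cases h3 : g 1 0 = 0 <;>
    by_cases h4 : g 1 1 = 0 <;> simp [h1, h2, h3, h4, ww_l, ww_r] at hd ⊢

lemma elEp_eq : elEp ℚ F = PP F * W F - TT F * W F := by
  rw [elEp, suppClass_eq, TT, PP, W, KK_mul_of, KK_mul_of, KK_sub]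
  congr 1; funext g
  have hd := detrel g
  by_cases h1 : g 0 0 = 0 <;> by_cases h2 : g 0 1 = 0 <;> by_cases h3 : g 1 0 = 0 <;>
    by_cases h4 : g 1 1 = 0 <;> simp [h1, h2, h3, h4, ww_r] at hd ⊢

lemma elEm_eq : elEm ℚ F = W F * PP F - TT F * W F := by
  rw [elEm, suppClass_eq, TT, PP, W, of_mul_KK, KK_mul_of, KK_sub]
  congr 1; funext g
  have hd := detrel g
  by_cases h1 : g 0 0 = 0 <;> by_cases h2 : g 0 1 = 0 <;> by_cases h3 : g 1 0 = 0 <;>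
    by_cases h4 : g 1 1 = 0 <;> simp [h1, h2, h3, h4, ww_l, ww_r] at hd ⊢

lemma total_eq : elA ℚ F + elB ℚ F + elC ℚ F + elDp ℚ F + elDm ℚ F + elEp ℚ F + elEm ℚ F
    = SS F := by
  simp only [elA, elB, elC, elDp, elDm, elEp, elEm, suppClass_eq, KK_add, SS]
  congr 1; funext g
  have hd := detrel g
  by_cases h1 : g 0 0 = 0 <;> by_cases h2 : g 0 1 = 0 <;> by_cases h3 : g 1 0 = 0 <;>
    by_cases h4 : g 1 1 = 0 <;> simp [h1, h2, h3, h4] at hd ⊢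

end helpers

section helpers2
variable {F : Type*} [Field F] [Fintype F] [DecidableEq F]

/-- general element of the seven dimensional algebra -/
noncomputable def LL (F : Type*) [Field F] [Fintype F] [DecidableEq F]
    (c1 c2 c3 c4 c5 c6 c7 : ℚ) : MonoidAlgebra ℚ (Matrix.SpecialLinearGroup (Fin 2) F) :=
  c1 • TT F + c2 • (TT F * W F) + c3 • PP F + c4 • (PP F * W F) + c5 • (W F * PP F) +
    c6 • (W F * (PP F * W F)) + c7 • SS F

lemma SS_SS (q : ℚ) (hq : q = Fintype.card F) (hq1 : q - 1 ≠ 0) :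
    SS F * SS F = (q ^ 3 - q) • SS F := by
  have h := PP_W_PP (F := F) q hq
  have hS : SS F = (q - 1)⁻¹ • (PP F * (W F * PP F)) + PP F := by
    rw [h, ← smul_sub, smul_smul, inv_mul_cancel₀ hq1, one_smul, sub_add_cancel]
  conv_lhs => enter [1]; rw [hS]
  simp only [add_mul, smul_mul_assoc, mul_assoc, PP_SS q hq, W_SS, mul_smul_comm, smul_smul]
  rw [← add_smul]
  congr 1
  field_simp
  ring

lemma LL_mul (q : ℚ) (hq : q = Fintype.card F) (hq1 : q - 1 ≠ 0)
    (c1 c2 c3 c4 c5 c6 c7 d1 d2 d3 d4 d5 d6 d7 : ℚ) :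
    LL F c1 c2 c3 c4 c5 c6 c7 * LL F d1 d2 d3 d4 d5 d6 d7 = LL F
      ((q - 1) * (c1 * d1 + c2 * d2))
      ((q - 1) * (c1 * d2 + c2 * d1))
      ((q - 1) * (c1 * d3 + c2 * d5 + c3 * (d1 + q * d3 - d5) + c4 * (d2 - d3 + q * d5)))
      ((q - 1) * (c1 * d4 + c2 * d6 + c3 * (d2 + q * d4 - d6) + c4 * (d1 - d4 + q * d6)))
      ((q - 1) * (c1 * d5 + c2 * d3 + c5 * (d1 + q * d3 - d5) + c6 * (d2 - d3 + q * d5)))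
      ((q - 1) * (c1 * d6 + c2 * d4 + c5 * (d2 + q * d4 - d6) + c6 * (d1 - d4 + q * d6)))
      ((q - 1) * ((c1 + c2) * d7 + (c3 + c5) * (d5 + d6 + q * d7) + (c4 + c6) * (d3 + d4 + q * d7)
        + c7 * (d1 + d2 + q * (d3 + d4 + d5 + d6)) + c7 * (q * (q + 1)) * d7)) := by
  have TWW : TT F * (W F * W F) = TT F := by rw [← mul_assoc, TT_W_W]
  have TWWx (x) : TT F * (W F * (W F * x)) = TT F * x := by
    rw [← mul_assoc, ← mul_assoc, TT_W_W]
  have PWW : PP F * (W F * W F) = PP F := by rw [← mul_assoc, PP_W_W]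
  have PWWx (x) : PP F * (W F * (W F * x)) = PP F * x := by
    rw [← mul_assoc, ← mul_assoc, PP_W_W]
  have WWPx (x) : W F * (W F * (PP F * x)) = PP F * x := by
    rw [← mul_assoc (W F) (PP F), ← mul_assoc, W_W_PP]
  have WTx (x) : W F * (TT F * x) = TT F * (W F * x) := by
    rw [← mul_assoc, W_TT, mul_assoc]
  have TTx (x) : TT F * (TT F * x) = (q - 1) • (TT F * x) := by
    rw [← mul_assoc, TT_TT q hq, smul_mul_assoc]
  have TPx (x) : TT F * (PP F * x) = (q - 1) • (PP F * x) := by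
    rw [← mul_assoc, TT_PP q hq, smul_mul_assoc]
  have TWP : TT F * (W F * PP F) = (q - 1) • (W F * PP F) := by
    rw [← mul_assoc, ← W_TT, mul_assoc, TT_PP q hq, mul_smul_comm]
  have TWPx (x) : TT F * (W F * (PP F * x)) = (q - 1) • (W F * (PP F * x)) := by
    rw [← mul_assoc, ← W_TT, mul_assoc, TPx, mul_smul_comm]
  have PTx (x) : PP F * (TT F * x) = (q - 1) • (PP F * x) := by
    rw [← mul_assoc, PP_TT q hq, smul_mul_assoc]
  have PPx (x) : PP F * (PP F * x) = (q * (q - 1)) • (PP F * x) := by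
    rw [← mul_assoc, PP_PP q hq, smul_mul_assoc]
  have PWPx (x) : PP F * (W F * (PP F * x)) = (q - 1) • (SS F * x) - (q - 1) • (PP F * x) := by
    rw [← mul_assoc (W F), ← mul_assoc, PP_W_PP q hq, sub_mul, smul_mul_assoc, smul_mul_assoc]
  have SWx (x) : SS F * (W F * x) = SS F * x := by rw [← mul_assoc, SS_W]
  have STx (x) : SS F * (TT F * x) = (q - 1) • (SS F * x) := by
    rw [← mul_assoc, SS_TT q hq, smul_mul_assoc]
  have SPx (x) : SS F * (PP F * x) = (q * (q - 1)) • (SS F * x) := by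
    rw [← mul_assoc, SS_PP q hq, smul_mul_assoc]
  simp only [LL, mul_add, add_mul, mul_sub, sub_mul, smul_mul_assoc, mul_smul_comm, mul_assoc,
    TWW, TWWx, PWW, PWWx, W_W_PP, WWPx, W_TT, WTx, TT_TT q hq, TTx, TT_PP q hq, TPx, TWP, TWPx,
    PP_TT q hq, PTx, PP_PP q hq, PPx, PP_W_PP q hq, PWPx, SS_W, SWx, SS_TT q hq, STx, SS_PP q hq,
    SPx, W_SS, TT_SS q hq, PP_SS q hq, SS_SS q hq hq1]
  module

lemma elA_LL : elA ℚ F = LL F 1 0 0 0 0 0 0 := by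
  rw [elA_eq, LL]; module
lemma elB_LL : elB ℚ F = LL F 0 1 0 0 0 0 0 := by
  rw [elB_eq, LL]; module
lemma elDp_LL : elDp ℚ F = LL F (-1) 0 1 0 0 0 0 := by
  rw [elDp_eq, LL]; module
lemma elDm_LL : elDm ℚ F = LL F (-1) 0 0 0 0 1 0 := by
  rw [elDm_eq, LL, mul_assoc]; module
lemma elEp_LL : elEp ℚ F = LL F 0 (-1) 0 1 0 0 0 := by
  rw [elEp_eq, LL]; module
lemma elEm_LL : elEm ℚ F = LL F 0 (-1) 0 0 1 0 0 := by
  rw [elEm_eq, LL]; module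
lemma elC_LL : elC ℚ F = LL F 1 1 (-1) (-1) (-1) (-1) 1 := by
  have h : elC ℚ F = SS F - (elA ℚ F + elB ℚ F + elDp ℚ F + elDm ℚ F + elEp ℚ F + elEm ℚ F) := by
    rw [← total_eq]; abel
  rw [h, elA_eq, elB_eq, elDp_eq, elDm_eq, elEp_eq, elEm_eq, LL, mul_assoc]; module

lemma LL_add (c1 c2 c3 c4 c5 c6 c7 d1 d2 d3 d4 d5 d6 d7 : ℚ) :
    LL F c1 c2 c3 c4 c5 c6 c7 + LL F d1 d2 d3 d4 d5 d6 d7 =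
      LL F (c1 + d1) (c2 + d2) (c3 + d3) (c4 + d4) (c5 + d5) (c6 + d6) (c7 + d7) := by
  simp only [LL]; module
lemma LL_sub (c1 c2 c3 c4 c5 c6 c7 d1 d2 d3 d4 d5 d6 d7 : ℚ) :
    LL F c1 c2 c3 c4 c5 c6 c7 - LL F d1 d2 d3 d4 d5 d6 d7 =
      LL F (c1 - d1) (c2 - d2) (c3 - d3) (c4 - d4) (c5 - d5) (c6 - d6) (c7 - d7) := by
  simp only [LL]; module
lemma LL_neg (c1 c2 c3 c4 c5 c6 c7 : ℚ) :
    -LL F c1 c2 c3 c4 c5 c6 c7 = LL F (-c1) (-c2) (-c3) (-c4) (-c5) (-c6) (-c7) := by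
  simp only [LL]; module
lemma LL_smul (c c1 c2 c3 c4 c5 c6 c7 : ℚ) :
    c • LL F c1 c2 c3 c4 c5 c6 c7 =
      LL F (c * c1) (c * c2) (c * c3) (c * c4) (c * c5) (c * c6) (c * c7) := by
  simp only [LL]; module
lemma LL_zero : (0 : MonoidAlgebra ℚ (Matrix.SpecialLinearGroup (Fin 2) F)) =
    LL F 0 0 0 0 0 0 0 := by
  simp [LL]

end helpers2

set_option maxHeartbeats 4000000 in
theorem pi_orthogonal_idempotents (F : Type*) [Field F] [Fintype F] [DecidableEq F]
    (hq : 2 < Fintype.card F) (q : ℚ) (hqc : q = Fintype.card F)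
    (π₁ π₂ π₃ π₄ : MonoidAlgebra ℚ (Matrix.SpecialLinearGroup (Fin 2) F))
    (hπ₁ : π₁ = (q ^ 3 - q)⁻¹ •
      (elA ℚ F + elB ℚ F + elC ℚ F + elDp ℚ F + elDm ℚ F + elEp ℚ F + elEm ℚ F))
    (hπ₂ : π₂ = ((q - 2) / (2 * (q ^ 2 - q))) • (elA ℚ F + elB ℚ F) +
      (q * (q - 1) ^ 2)⁻¹ • elC ℚ F -
      ((q - 2) / (2 * q * (q - 1) ^ 2)) • (elDp ℚ F + elDm ℚ F + elEp ℚ F + elEm ℚ F))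
    (hπ₃ : π₃ = (2 * (q + 1))⁻¹ • (elA ℚ F - elB ℚ F) +
      (2 * (q ^ 2 - 1))⁻¹ • (-elDp ℚ F - elDm ℚ F + elEp ℚ F + elEm ℚ F))
    (hπ₄ : π₄ = ((q + 1) * (q - 1) ^ 2)⁻¹ •
      ((2 * (q - 1)) • elA ℚ F - (2 : ℚ) • elC ℚ F + (q - 2) • (elDp ℚ F + elDm ℚ F) -
        (elEp ℚ F + elEm ℚ F))) :
    (π₁ * π₁ = π₁ ∧ π₂ * π₂ = π₂ ∧ π₃ * π₃ = π₃ ∧ π₄ * π₄ = π₄) ∧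
    (π₁ * π₂ = 0 ∧ π₂ * π₁ = 0 ∧ π₁ * π₃ = 0 ∧ π₃ * π₁ = 0 ∧ π₁ * π₄ = 0 ∧ π₄ * π₁ = 0 ∧
     π₂ * π₃ = 0 ∧ π₃ * π₂ = 0 ∧ π₂ * π₄ = 0 ∧ π₄ * π₂ = 0 ∧ π₃ * π₄ = 0 ∧ π₄ * π₃ = 0) ∧
    π₁ + π₂ + π₃ + π₄ = (q - 1)⁻¹ • elA ℚ F ∧
    (∀ X ∈ ({elA ℚ F, elB ℚ F, elC ℚ F, elDp ℚ F, elDm ℚ F, elEp ℚ F, elEm ℚ F} : Set (MonoidAlgebra ℚ (Matrix.SpecialLinearGroup (Fin 2) F))),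
      ((q - 1)⁻¹ • elA ℚ F) * X = X ∧ X * ((q - 1)⁻¹ • elA ℚ F) = X) := by
  have hq2 : 2 < q := by rw [hqc]; exact_mod_cast hq
  have h0 : q ≠ 0 := by linarith
  have h1 : q - 1 ≠ 0 := by intro h; linarith
  have h2 : q + 1 ≠ 0 := by intro h; linarith
  have e1 : q ^ 3 - q = q * (q - 1) * (q + 1) := by ring
  have e2 : q ^ 2 - q = q * (q - 1) := by ring
  have e3 : q ^ 2 - 1 = (q - 1) * (q + 1) := by ring
  rw [e1] at hπ₁
  rw [e2] at hπ₂
  rw [e3] at hπ₃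
  simp only [elA_LL, elB_LL, elC_LL, elDp_LL, elDm_LL, elEp_LL, elEm_LL, LL_add, LL_sub, LL_neg,
    LL_smul] at hπ₁ hπ₂ hπ₃ hπ₄ ⊢
  refine ⟨⟨?_, ?_, ?_, ?_⟩, ⟨?_, ?_, ?_, ?_, ?_, ?_, ?_, ?_, ?_, ?_, ?_, ?_⟩, ?_, ?_⟩
  on_goal 18 =>
    intro X hX
    simp only [Set.mem_insert_iff, Set.mem_singleton_iff] at hX
    rcases hX with rfl | rfl | rfl | rfl | rfl | rfl | rfl <;>
    · simp only [LL_mul q hqc h1]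
      constructor <;> congr 1 <;> field_simp <;> ring
  all_goals
    simp only [hπ₁, hπ₂, hπ₃, hπ₄, LL_mul q hqc h1, LL_add, LL_zero]
    congr 1 <;> field_simp <;> ring
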